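/- Let ω and ν be cyclically balanced finite words over {0,1} with ω = 0-max_ω, ν = 1-min_ν, ℓ(ω) = ℓ(ν) and 1(ω) = 1(ν). Then the lexicographic subshift (Σ_{(α,β)}, σ) with α = σ(ω ν^∞) and β = σ(ν ω^∞) is topologically transitive. -/

import Mathlib

open Filter MeasureTheory

namespace DoublingHole

/-- One-sided binary sequences (indexed from 0, corresponding to x₁x₂x₃⋯). -/
abbrev Seq : Type := ℕ → Bool

/-- The one-sided shift map σ. -/
def shift (x : Seq) : Seq := fun n => x (n + 1)

/-- Strict lexicographic order ≺ on sequences. -/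
def lexLt (x y : Seq) : Prop := ∃ k : ℕ, (∀ i, i < k → x i = y i) ∧ x k < y k

/-- Reflexive lexicographic order ≼ on sequences. -/
def lexLe (x y : Seq) : Prop := lexLt x y ∨ x = y

/-- The lexicographic subshift Σ_{(α,β)} = {x : β ≼ σⁿx ≼ α for all n ≥ 0}. -/
def lexSubshift (α β : Seq) : Set Seq :=
  {x | ∀ n : ℕ, lexLe β (shift^[n] x) ∧ lexLe (shift^[n] x) α}

/-- The projection π : Σ₂ → [0,1], π(x) = Σ xᵢ 2^{-i}. -/
noncomputable def piMap (x : Seq) : ℝ := ∑' i : ℕ, if x i then (1 : ℝ) / 2 ^ (i + 1) else 0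

/-- The mirror image x̄ of a sequence. -/
def mirror (x : Seq) : Seq := fun n => !(x n)

/-- The set P of Parry sequences: α₁ = 1 and σⁿα ≼ α for all n ≥ 1. -/
def ParryP : Set Seq := {α | α 0 = true ∧ ∀ n, 1 ≤ n → lexLe (shift^[n] α) α}

/-- The set P̄ of mirror images of Parry sequences. -/
def barP : Set Seq := {β | mirror β ∈ ParryP}

/-- Periodic sequences. -/
def PerSet : Set Seq := {x | ∃ k, 1 ≤ k ∧ shift^[k] x = x}

/-- Membership in the lexicographic world LW. -/
def inLW (α β : Seq) : Prop :=
  α ∈ ParryP ∧ β ∈ barP ∧ ∀ n, 1 ≤ n → lexLe β (shift^[n] α) ∧ lexLe (shift^[n] β) α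

/-- The doubling map x ↦ 2x (mod 1) on S¹ identified with [0,1). -/
noncomputable def dbl (x : ℝ) : ℝ := Int.fract (2 * x)

/-- The exceptional set X_{(a,b)} of points whose orbit avoids the hole (a,b). -/
def Xset (a b : ℝ) : Set ℝ :=
  {x | x ∈ Set.Ico (0 : ℝ) 1 ∧ ∀ n : ℕ, dbl^[n] x ∉ Set.Ioo a b}

/-- The attractor Λ_{(a,b)} = [2b-1, 2a] ∩ X_{(a,b)}. -/
def Lam (a b : ℝ) : Set ℝ := Set.Icc (2 * b - 1) (2 * a) ∩ Xset a b

/-- χ(a) = sup{b : X_{(a,b)} is uncountable}. -/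
noncomputable def chiFn (a : ℝ) : ℝ :=
  sSup {b | b ∈ Set.Ico (0 : ℝ) 1 ∧ ¬ (Xset a b).Countable}

/-- The parameter region D₁. -/
def D1 : Set (ℝ × ℝ) :=
  {p | p.1 ∈ Set.Ioo (1/4 : ℝ) (1/2) ∧ p.2 ∈ Set.Ioo (1/2 : ℝ) (3/4) ∧ p.2 ≤ chiFn p.1}

/-- The set S of parameters whose endpoints both fall into the hole. -/
def Sset : Set (ℝ × ℝ) :=
  {p | p ∈ D1 ∧ (∃ n, 1 ≤ n ∧ dbl^[n] p.1 ∈ Set.Ioo p.1 p.2) ∧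
        ∃ m, 1 ≤ m ∧ dbl^[m] p.2 ∈ Set.Ioo p.1 p.2}

/-- The finite word w occurs in (is a factor of) the sequence x. -/
def occursIn (w : List Bool) (x : Seq) : Prop :=
  ∃ i : ℕ, w = List.ofFn fun j : Fin w.length => x (i + (j : ℕ))

/-- The language of a subshift: all finite factors of its elements. -/
def Lang (A : Set Seq) : Set (List Bool) := {w | ∃ x ∈ A, occursIn w x}

/-- A set of sequences is a subshift of finite type if it is defined by
finitely many forbidden words. -/
def IsSFT (A : Set Seq) : Prop :=
  ∃ F : Finset (List Bool), A = {x | ∀ w ∈ F, ¬ occursIn w x}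

/-- B_n(A): the admissible words of length n. -/
def wordsOfLen (A : Set Seq) (n : ℕ) : Set (List Bool) :=
  {w | w.length = n ∧ w ∈ Lang A}

/-- Topological transitivity of a subshift, phrased via its language. -/
def TransitiveShift (A : Set Seq) : Prop :=
  ∀ u ∈ Lang A, ∀ v ∈ Lang A, ∃ t ∈ Lang A, u ++ t ++ v ∈ Lang A

/-- Cyclic rotation of a finite word. -/
def rot (w : List Bool) (k : ℕ) : List Bool := w.drop k ++ w.take k

/-- Lexicographic (dictionary) order on finite words. -/
def listLe (u v : List Bool) : Prop := List.Lex (· < ·) u v ∨ u = v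

/-- w = 0-max_w : w starts with 0 and is the lexicographically largest
cyclic permutation of itself starting with 0. -/
def isZeroMax (w : List Bool) : Prop :=
  w.headD true = false ∧
    ∀ k, k < w.length → (rot w k).headD true = false → listLe (rot w k) w

/-- w = 1-min_w : w starts with 1 and is the lexicographically smallest
cyclic permutation of itself starting with 1. -/
def isOneMin (w : List Bool) : Prop :=
  w.headD false = true ∧
    ∀ k, k < w.length → (rot w k).headD false = true → listLe w (rot w k)

/-- v is the 0-max cyclic permutation of w. -/
def isZeroMaxOf (v w : List Bool) : Prop :=
  (∃ k, k < w.length ∧ v = rot w k) ∧ v.headD true = false ∧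
    ∀ k, k < w.length → (rot w k).headD true = false → listLe (rot w k) v

/-- u is the 1-min cyclic permutation of w. -/
def isOneMinOf (u w : List Bool) : Prop :=
  (∃ k, k < w.length ∧ u = rot w k) ∧ u.headD false = true ∧
    ∀ k, k < w.length → (rot w k).headD false = true → listLe u (rot w k)

/-- The periodic sequence w^∞. -/
def periodicSeq (w : List Bool) : Seq := fun i => w.getD (i % w.length) false

/-- The sequence w followed by x. -/
def wordThen (w : List Bool) (x : Seq) : Seq :=
  fun i => if i < w.length then w.getD i false else x (i - w.length)

/-- Prepend one symbol to a sequence (e.g. 0α, 1β). -/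
def consSeq (a : Bool) (x : Seq) : Seq := fun i => if i = 0 then a else x (i - 1)

/-- A word is balanced if any two factors of equal length have numbers of 1's
differing by at most one. -/
def balanced (w : List Bool) : Prop :=
  ∀ u v : List Bool, u <:+: w → v <:+: w → u.length = v.length →
    ((u.count true : ℤ) - (v.count true : ℤ)).natAbs ≤ 1

/-- A word is cyclically balanced if its square is balanced. -/
def cycBalanced (w : List Bool) : Prop := balanced (w ++ w)

/-- Infinite concatenation of a sequence of (nonempty) finite words. -/
noncomputable def concatSeq (b : ℕ → List Bool) : Seq := fun i =>
  (b (sInf {n : ℕ | i < ∑ k ∈ Finset.range (n + 1), (b k).length})).getD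
    (i - ∑ k ∈ Finset.range (sInf {n : ℕ | i < ∑ k ∈ Finset.range (n + 1), (b k).length}), (b k).length)
    false

/-- (α,β) is renormalisable by the finite words ω and ν:
ω = 0-max_ω, ν = 1-min_ν, (0-max_ν)^∞ ≺ ω^∞, ν^∞ ≺ (1-min_ω)^∞, ℓ(ων) ≥ 3, and
0α = ω ν^{n₁^ν} ω^{n₁^ω} ν^{n₂^ν} ⋯ and 1β = ν ω^{m₁^ω} ν^{m₁^ν} ⋯ with all
exponents in ℕ ∪ {∞}; equivalently 0α (resp. 1β) is an infinite concatenation of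
copies of ω and ν whose first two blocks are ω, ν (resp. ν, ω). -/
def RenormalisableBy (α β : Seq) (ω ν : List Bool) : Prop :=
  isZeroMax ω ∧ isOneMin ν ∧
  (∀ v, isZeroMaxOf v ν → lexLt (periodicSeq v) (periodicSeq ω)) ∧
  (∀ u, isOneMinOf u ω → lexLt (periodicSeq ν) (periodicSeq u)) ∧
  3 ≤ ω.length + ν.length ∧
  (∃ b : ℕ → List Bool, b 0 = ω ∧ b 1 = ν ∧ (∀ k, b k = ω ∨ b k = ν) ∧
    consSeq false α = concatSeq b) ∧
  (∃ c : ℕ → List Bool, c 0 = ν ∧ c 1 = ω ∧ (∀ k, c k = ω ∨ c k = ν) ∧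
    consSeq true β = concatSeq c)

/-- (α,β) is renormalisable by an infinite sequence: either 0α = ω and 1β = νω
with ω infinite and ν = 1-min_ν finite, or 0α = ων and 1β = ν with ν infinite
and ω = 0-max_ω finite. -/
def RenormInfBy (α β : Seq) : Prop :=
  (∃ ν : List Bool, isOneMin ν ∧ consSeq true β = wordThen ν (consSeq false α)) ∨
  (∃ ω : List Bool, isZeroMax ω ∧ consSeq false α = wordThen ω (consSeq true β))

/-- n_α = min{n ≥ 1 : σⁿα ≻ α}. -/
noncomputable def nAlpha (α : Seq) : ℕ := sInf {n | 1 ≤ n ∧ lexLt α (shift^[n] α)}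

/-- The periodic sequence (α₁ ⋯ α_{n-1} 0)^∞. -/
def cutZero (α : Seq) (n : ℕ) : Seq :=
  fun i => if i % n = n - 1 then false else α (i % n)

/-- The periodic sequence (β₁ ⋯ β_{n-1} 1)^∞. -/
def cutOne (β : Seq) (n : ℕ) : Seq :=
  fun i => if i % n = n - 1 then true else β (i % n)

open Classical in
/-- The map ς : Σ₂¹ → Σ₂¹. -/
noncomputable def varsigma (α : Seq) : Seq :=
  if α ∈ ParryP then α else cutZero α (nAlpha α)

/-- The map ς' : Σ₂⁰ → Σ₂⁰, ς'(β) = mirror of ς(β̄). -/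
noncomputable def varsigma' (β : Seq) : Seq := mirror (varsigma (mirror β))

/-- M_α(β) = min{m ≥ 1 : σ^m β ≻ α}. -/
noncomputable def Msub (α β : Seq) : ℕ := sInf {m | 1 ≤ m ∧ lexLt α (shift^[m] β)}

/-- N_β(α) = min{n ≥ 1 : σⁿ α ≺ β}. -/
noncomputable def Nsub (α β : Seq) : ℕ := sInf {n | 1 ≤ n ∧ lexLt (shift^[n] α) β}

/-- ι(α) = (α₁ ⋯ α_{N_β(α)-1} 0)^∞. -/
noncomputable def iotaA (α β : Seq) : Seq := cutZero α (Nsub α β)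

/-- ι(β) = (β₁ ⋯ β_{M_α(β)-1} 1)^∞. -/
noncomputable def iotaB (α β : Seq) : Seq := cutOne β (Msub α β)

/-- ξ_α(β) = (β₁ ⋯ β_{M-1} 1)^∞ with M = M_α(β). -/
noncomputable def xiA (α β : Seq) : Seq := cutOne β (Msub α β)

/-- ξ'_β(α) = (α₁ ⋯ α_{N-1} 0)^∞ with N = N_β(α). -/
noncomputable def xiB (α β : Seq) : Seq := cutZero α (Nsub α β)

/-- A two sided extremal pair. -/
def twoSidedExtremal (α β : Seq) : Prop :=
  (∃ n, 1 ≤ n ∧ lexLt α (shift^[n] β)) ∧ (∃ m, 1 ≤ m ∧ lexLt (shift^[m] α) β)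

/-- A right extremal pair. -/
def rightExtremal (α β : Seq) : Prop :=
  (∀ m, 1 ≤ m → lexLt β (shift^[m] α)) ∧ (∃ n, 1 ≤ n ∧ lexLt α (shift^[n] β))

/-- A left extremal pair. -/
def leftExtremal (α β : Seq) : Prop :=
  (∀ n, 1 ≤ n → lexLt (shift^[n] β) α) ∧ (∃ m, 1 ≤ m ∧ lexLt (shift^[m] α) β)

/-- Dyadic rationals. -/
def IsDyadic (t : ℝ) : Prop := ∃ (z : ℤ) (n : ℕ), t = (z : ℝ) / 2 ^ n

/-- α₁ ⋯ α_n 1^∞. -/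
def onesAfter (α : Seq) (n : ℕ) : Seq := fun i => if i < n then α i else true

end DoublingHole

namespace DoublingHole

/-! ### Lexicographic order, shifts and mirror images -/

lemma shift_iterate_apply (k : ℕ) (x : Seq) (t : ℕ) : shift^[k] x t = x (k + t) := by
  induction k generalizing x with
  | zero => simp
  | succ k ih =>
    rw [Function.iterate_succ_apply, ih]
    simp only [shift]
    congr 1
    omega

lemma lexLe_or_lexLt (x y : Seq) : lexLe x y ∨ lexLt y x := by
  by_cases h : x = y
  · exact Or.inl (Or.inr h)
  · have hex : ∃ k, x k ≠ y k := Function.ne_iff.mp h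
    classical
    have hk := Nat.find_spec hex
    have hlt : ∀ i, i < Nat.find hex → x i = y i := fun i hi => not_not.mp (Nat.find_min hex hi)
    rcases lt_or_gt_of_ne hk with h1 | h1
    · exact Or.inl (Or.inl ⟨_, hlt, h1⟩)
    · exact Or.inr ⟨_, fun i hi => (hlt i hi).symm, h1⟩

lemma lexLe_mirror {x y : Seq} (h : lexLe x y) : lexLe (mirror y) (mirror x) := by
  rcases h with ⟨k, hk, hlt⟩ | rfl
  · refine Or.inl ⟨k, fun i hi => by simp [mirror, hk i hi], ?_⟩
    simp only [mirror]
    revert hlt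
    cases x k <;> cases y k <;> decide
  · exact Or.inr rfl

@[simp] lemma mirror_mirror (x : Seq) : mirror (mirror x) = x := by
  funext t
  simp [mirror]

/-! ### Heights -/

/-- `E` is a height function of `x`: a letter `1` raises the height by `N - M`, a letter `0`
lowers it by `M`. -/
def IsHeight (N M : ℤ) (x : Seq) (E : ℕ → ℤ) : Prop :=
  ∀ t, E (t + 1) = E t - M + if x t then N else 0

namespace IsHeight

variable {N M : ℤ} {x y : Seq} {E F : ℕ → ℤ}

lemma of_false (h : IsHeight N M x E) {t : ℕ} (ht : x t = false) : E (t + 1) = E t - M := by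
  simpa [ht] using h t

lemma of_true (h : IsHeight N M x E) {t : ℕ} (ht : x t = true) : E (t + 1) = E t - M + N := by
  simpa [ht] using h t

lemma mirror (h : IsHeight N M x E) (c : ℤ) :
    IsHeight N (N - M) (mirror x) (fun t => c - E t) := by
  intro t
  cases hx : x t
  · simp [DoublingHole.mirror, hx, h.of_false hx]
    ring
  · simp [DoublingHole.mirror, hx, h.of_true hx]
    ring

lemma shift_iterate (h : IsHeight N M x E) (k : ℕ) :
    IsHeight N M (shift^[k] x) (fun t => E (k + t)) := by
  intro t
  rw [shift_iterate_apply]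
  exact h (k + t)

lemma sub_const (h : IsHeight N M x E) (c : ℤ) : IsHeight N M x (fun t => E t - c) := by
  intro t
  have := h t
  simp only [this]
  ring

lemma sub_eq_of_agree (hx : IsHeight N M x E) (hy : IsHeight N M y F) {k : ℕ}
    (hk : ∀ i, i < k → x i = y i) : E k - E 0 = F k - F 0 := by
  induction k with
  | zero => simp
  | succ k ih =>
    have h1 := ih fun i hi => hk i (by omega)
    rw [hx k, hy k, hk k (by omega)]
    linarith

lemma dvd (h : IsHeight N M x E) (t : ℕ) : N ∣ E t - (E 0 - t * M) := by
  induction t with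
  | zero => simp
  | succ t ih =>
    obtain ⟨c, hc⟩ := ih
    cases hx : x t
    · exact ⟨c, by rw [h.of_false hx, ← hc]; push_cast; ring⟩
    · exact ⟨c + 1, by rw [h.of_true hx, mul_add, ← hc]; push_cast; ring⟩

end IsHeight

lemma exists_isHeight (N M : ℤ) (x : Seq) : ∃ E, IsHeight N M x E :=
  ⟨fun t => ∑ i ∈ Finset.range t, (-M + if x i then N else 0), fun t => by
    simp only [Finset.sum_range_succ]; ring⟩

lemma exists_nat_dvd_sub_mul {N M : ℤ} (hN : 0 < N) (hco : IsCoprime M N) (c : ℤ) :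
    ∃ t : ℕ, (t : ℤ) < N ∧ N ∣ c - t * M := by
  obtain ⟨a, b, hab⟩ := hco
  have h0 := Int.emod_nonneg (c * a) hN.ne'
  refine ⟨((c * a) % N).toNat, ?_, ?_⟩
  · rw [Int.toNat_of_nonneg h0]
    exact Int.emod_lt_of_pos _ hN
  · rw [Int.toNat_of_nonneg h0]
    refine ⟨c * b + (c * a / N) * M, ?_⟩
    have h1 := Int.emod_add_mul_ediv (c * a) N
    have h2 : c * a % N = c * a - N * (c * a / N) := by linarith
    rw [h2]
    linear_combination (-c) * hab

lemma eq_of_dvd_sub_of_lt {N a b : ℤ} (h : N ∣ a - b) (ha : 0 ≤ a) (ha' : a < N) (hb : 0 ≤ b)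
    (hb' : b < N) : a = b := by
  have := Int.eq_zero_of_abs_lt_dvd h (abs_lt.mpr ⟨by linarith, by linarith⟩)
  linarith

lemma IsHeight.exists_eq {N M : ℤ} {x : Seq} {E : ℕ → ℤ} (h : IsHeight N M x E) (hN : 0 < N)
    (hco : IsCoprime M N) (hE : ∀ t, 0 ≤ E t ∧ E t < N) {r : ℤ} (hr : 0 ≤ r) (hr' : r < N) :
    ∃ t : ℕ, (t : ℤ) < N ∧ E t = r := by
  obtain ⟨t, ht, hd⟩ := exists_nat_dvd_sub_mul hN hco (E 0 - r)
  refine ⟨t, ht, eq_of_dvd_sub_of_lt ?_ (hE t).1 (hE t).2 hr hr'⟩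
  have := dvd_add (h.dvd t) hd
  obtain ⟨c, hc⟩ := this
  exact ⟨c, by linear_combination hc⟩

/-- A sequence of balanced heights that is the largest of its shifts starting with `0` starts
at height `M`. -/
lemma IsHeight.zero_eq_of_max {N M : ℤ} {x : Seq} {E : ℕ → ℤ} (h : IsHeight N M x E)
    (hM : 0 < M) (hMN : M < N) (hco : IsCoprime M N) (hE : ∀ t, 0 ≤ E t ∧ E t < N)
    (h0 : x 0 = false)
    (hmax : ∀ k : ℕ, (k : ℤ) < N → x k = false → lexLe (shift^[k] x) x) : E 0 = M := by
  have hN : 0 < N := hM.trans hMN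
  have hge : M ≤ E 0 := by
    have h1 := h.of_false h0
    have h2 := (hE (0 + 1)).1
    linarith
  by_contra hne
  have hgt : M < E 0 := lt_of_le_of_ne hge (Ne.symm hne)
  obtain ⟨k, hk, hEk⟩ := h.exists_eq hN hco hE hM.le hMN
  have hxk : x k = false := by
    by_contra hx
    have h1 := h.of_true (Bool.eq_true_of_not_eq_false hx)
    have h2 := (hE (k + 1)).2
    linarith
  have hs := h.shift_iterate k
  rcases hmax k hk hxk with ⟨t, hag, hlt⟩ | heq
  · have hd := hs.sub_eq_of_agree h hag
    simp only [add_zero] at hd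
    obtain ⟨hf, ht⟩ := Bool.lt_iff.mp hlt
    have h1 := hs.of_false hf
    have h2 := h.of_true ht
    have h3 := (hE (k + (t + 1))).1
    have h4 := (hE (t + 1)).2
    linarith
  · obtain ⟨t, -, ht⟩ := h.exists_eq hN hco hE le_rfl hN
    have hd := hs.sub_eq_of_agree h (k := t) fun i _ => by rw [heq]
    simp only [add_zero] at hd
    have := (hE (k + t)).1
    linarith

/-! ### Extremal sequences and windows -/

/-- `α` has heights in `[0, N]` starting from `0`, and either it is the largest such sequence
(`W = N`), or it comes back to `0` before the first visit of `N` (`W = N - 1`). -/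
def IsUpper (N M W : ℤ) (α : Seq) : Prop :=
  ∃ F, F 0 = 0 ∧ (∀ t, 0 ≤ F t ∧ F t ≤ N) ∧ IsHeight N M α F ∧
    ((W = N ∧ ∀ t, F t = M → α t = true) ∨
      (W = N - 1 ∧ ∃ T, 0 < T ∧ F T = 0 ∧ ∀ t ≤ T, F t < N))

lemma IsUpper.lexLe {N M W : ℤ} {α z : Seq} {E : ℕ → ℤ} (hα : IsUpper N M W α)
    (hz : IsHeight N M z E) (hE : ∀ t, 0 ≤ E t ∧ E t ≤ W) : lexLe z α := by
  obtain ⟨F, hF0, hF, hαF, hW⟩ := hα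
  rcases lexLe_or_lexLt z α with h | ⟨k, hag, hlt⟩
  · exact h
  · exfalso
    have hd := hαF.sub_eq_of_agree hz hag
    obtain ⟨hf, ht⟩ := Bool.lt_iff.mp hlt
    have h1 := hαF.of_false hf
    have h2 := hz.of_true ht
    have h3 := (hF (k + 1)).1
    have h4 := (hE (k + 1)).2
    have h5 := (hE 0).1
    rcases hW with ⟨rfl, hg⟩ | ⟨rfl, -⟩
    · have : F k ≠ M := fun h => by simp [hg k h] at hf
      have : M < F k := lt_of_le_of_ne (by linarith) this.symm
      linarith
    · linarith

lemma IsUpper.sub_le {N M W : ℤ} {α x : Seq} {D : ℕ → ℤ} (hW0 : 0 ≤ W)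
    (hα : IsUpper N M W α) (hx : IsHeight N M x D) {i l : ℕ}
    (hle : DoublingHole.lexLe (shift^[i] x) α)
    (hl : ∀ l' < l, ∀ i, D (i + l') - D i ≤ W) : D (i + l) - D i ≤ W := by
  obtain ⟨F, hF0, hF, hαF, hW⟩ := hα
  by_contra! hcon
  have hint : ∀ t, 0 < t → t < l → 1 ≤ D (i + t) - D i := by
    intro t h0 ht
    have := hl (l - t) (by omega) (i + t)
    rw [show i + t + (l - t) = i + l by omega] at this
    linarith
  have hs := hx.shift_iterate i
  have hagree : ∀ t < l, shift^[i] x t = α t := by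
    rcases hle with ⟨k, hag, hlt⟩ | heq
    · by_cases hk : k < l
      · exfalso
        have hd := hs.sub_eq_of_agree hαF hag
        obtain ⟨hf, ht⟩ := Bool.lt_iff.mp hlt
        have h1 := hs.of_false hf
        have h2 := hαF.of_true ht
        have h3 := (hF (k + 1)).2
        simp only [add_zero] at hd h1
        rcases Nat.lt_or_ge (k + 1) l with h | h
        · have := hint (k + 1) (by omega) h
          linarith
        · have hkl : k + 1 = l := by omega
          rw [← hkl] at hcon
          linarith
      · exact fun t ht => hag t (by omega)
    · exact fun t _ => by rw [heq]
  have hdl := hs.sub_eq_of_agree hαF hagree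
  simp only [add_zero] at hdl
  rcases hW with ⟨rfl, -⟩ | ⟨rfl, T, hT, hFT, hlt⟩
  · have := (hF l).2
    linarith
  · rcases Nat.lt_or_ge T l with h | h
    · have hdT := hs.sub_eq_of_agree hαF (k := T) fun j hj => hagree j (by omega)
      simp only [add_zero] at hdT
      have := hint T hT h
      linarith
    · have := hlt l h
      linarith

/-- `z` has a height function with values in `[0, W]` starting at `e`. -/
def InWindow (N M W e : ℤ) (z : Seq) : Prop :=
  ∃ E, E 0 = e ∧ IsHeight N M z E ∧ ∀ t, 0 ≤ E t ∧ E t ≤ W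

lemma mem_lexSubshift_iff_inWindow {N M W : ℤ} {α β : Seq} (hW : 0 ≤ W)
    (hα : IsUpper N M W α) (hβ : IsUpper N (N - M) W (mirror β)) (x : Seq) :
    x ∈ lexSubshift α β ↔ ∃ e, InWindow N M W e x := by
  constructor
  · intro hx
    obtain ⟨D, hD⟩ := exists_isHeight N M x
    have key : ∀ l i, D (i + l) - D i ≤ W ∧ D i - D (i + l) ≤ W := by
      intro l
      induction l using Nat.strong_induction_on with
      | _ l ih =>
        intro i
        refine ⟨hα.sub_le hW hD (hx i).2 fun l' hl' i => (ih l' hl' i).1, ?_⟩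
        have hm : lexLe (shift^[i] (mirror x)) (mirror β) := by
          have := lexLe_mirror (hx i).1
          convert this using 1
          funext t
          simp [shift_iterate_apply, mirror]
        have := hβ.sub_le hW (hD.mirror 0) hm (l := l) fun l' hl' i => by
          have := (ih l' hl' i).2
          linarith
        linarith
    have hbd : ∀ i j, D i - D j ≤ W := by
      intro i j
      rcases le_total i j with h | h
      · have := (key (j - i) i).2
        rwa [Nat.add_sub_cancel' h] at this
      · have := (key (i - j) j).1
        rwa [Nat.add_sub_cancel' h] at this
    obtain ⟨d, ⟨j, hj⟩, hd⟩ := Int.exists_least_of_bdd (P := fun d => ∃ j, D j = d)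
      ⟨D 0 - W, fun z ⟨j, hj⟩ => by have := hbd 0 j; linarith⟩ ⟨D 0, 0, rfl⟩
    refine ⟨D 0 - d, fun t => D t - d, rfl, hD.sub_const d, fun t => ⟨?_, ?_⟩⟩
    · have := hd (D t) ⟨t, rfl⟩
      linarith
    · have := hbd t j
      linarith
  · rintro ⟨e, E, -, hE, hb⟩ k
    refine ⟨?_, hα.lexLe (hE.shift_iterate k) fun t => hb _⟩
    have := hβ.lexLe ((hE.shift_iterate k).mirror W) fun t =>
      ⟨by have := (hb (k + t)).2; linarith, by have := (hb (k + t)).1; linarith⟩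
    simpa using lexLe_mirror this

/-! ### Connecting sequences inside a window -/

lemma InWindow.cons {N M W e e' : ℤ} {z : Seq} (b : Bool) (h : InWindow N M W e' z)
    (h0 : 0 ≤ e) (hW : e ≤ W) (he : e' = e - M + if b then N else 0) :
    InWindow N M W e (consSeq b z) := by
  obtain ⟨E, hE0, hE, hb⟩ := h
  refine ⟨fun t => if t = 0 then e else E (t - 1), by simp, ?_, ?_⟩
  · intro t
    rcases t with _ | t
    · simp [consSeq, hE0, he]
    · simpa [consSeq] using hE t
  · intro t
    rcases t with _ | t
    · simp [h0, hW]
    · simpa using hb t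

@[simp] lemma wordThen_nil (z : Seq) : wordThen [] z = z := by
  funext t
  simp [wordThen]

lemma wordThen_cons (b : Bool) (w : List Bool) (z : Seq) :
    wordThen (b :: w) z = consSeq b (wordThen w z) := by
  funext t
  rcases t with _ | t
  · simp [wordThen, consSeq]
  · simp [wordThen, consSeq]

lemma wordThen_append (u w : List Bool) (z : Seq) :
    wordThen (u ++ w) z = wordThen u (wordThen w z) := by
  induction u with
  | nil => simp
  | cons b u ih => rw [List.cons_append, wordThen_cons, wordThen_cons, ih]

lemma occursIn_wordThen (w : List Bool) (z : Seq) : occursIn w (wordThen w z) := by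
  refine ⟨0, List.ext_getElem (by simp) fun i h1 h2 => ?_⟩
  simp [wordThen]

lemma occursIn.exists_eq_wordThen {w : List Bool} {x : Seq} (h : occursIn w x) :
    ∃ i, shift^[i] x = wordThen w (shift^[i + w.length] x) := by
  obtain ⟨i, hi⟩ := h
  refine ⟨i, funext fun t => ?_⟩
  simp only [shift_iterate_apply, wordThen]
  split_ifs with ht
  · have h1 : w[t] = x (i + t) := by
      have := List.getElem_of_eq hi ht
      simpa using this
    simp [ht, h1]
  · congr 1
    omega

lemma IsHeight.inWindow_wordThen {N M W : ℤ} {x s z : Seq} {E : ℕ → ℤ} (w : List Bool)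
    (hx : x = wordThen w s) (h : IsHeight N M x E) (hE : ∀ t, 0 ≤ E t ∧ E t ≤ W)
    (hz : InWindow N M W (E w.length) z) : InWindow N M W (E 0) (wordThen w z) := by
  induction w generalizing x E with
  | nil => simpa using hz
  | cons b w ih =>
    rw [wordThen_cons] at hx ⊢
    have h1 : shift^[1] x = wordThen w s := by
      funext t
      rw [shift_iterate_apply, hx]
      simp [consSeq]
    have h2 := ih h1 (h.shift_iterate 1) (fun t => hE _) (by simpa [add_comm] using hz)
    refine InWindow.cons b h2 (hE 0).1 (hE 0).2 ?_
    have h3 : x 0 = b := by simp [hx, consSeq]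
    have := h 0
    rw [h3] at this
    simpa using this

/-- The rotation of heights by `-M`. -/
def heightStep (N M e : ℤ) : ℤ := if e < M then e - M + N else e - M

lemma heightStep_iterate {N M : ℤ} (hM : 0 < M) (hMN : M < N) (k : ℕ) {e : ℤ} (h0 : 0 ≤ e)
    (hN : e ≤ N) : 0 ≤ (heightStep N M)^[k + 1] e ∧ (heightStep N M)^[k + 1] e < N ∧
      N ∣ (heightStep N M)^[k + 1] e - (e - (k + 1) * M) := by
  have hstep : ∀ a, 0 ≤ a → a ≤ N → 0 ≤ heightStep N M a ∧ heightStep N M a < N ∧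
      N ∣ heightStep N M a - (a - M) := by
    intro a h1 h2
    unfold heightStep
    split_ifs with h
    · exact ⟨by linarith, by linarith, 1, by ring⟩
    · exact ⟨by linarith, by linarith, 0, by ring⟩
  induction k with
  | zero => simpa using hstep e h0 hN
  | succ k ih =>
    obtain ⟨i1, i2, i3⟩ := ih
    rw [Function.iterate_succ_apply']
    obtain ⟨j1, j2, j3⟩ := hstep _ i1 i2.le
    refine ⟨j1, j2, ?_⟩
    have := dvd_add i3 j3
    obtain ⟨c, hc⟩ := this
    exact ⟨c, by push_cast; linear_combination hc⟩

lemma InWindow.exists_wordThen_of_iterate {N M W : ℤ} {z : Seq} (hM : 0 < M) (hMN : M < N)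
    (hW : N - 1 ≤ W) (hWN : W ≤ N) (k : ℕ) {e : ℤ} (h0 : 0 ≤ e) (he : e ≤ W)
    (hz : InWindow N M W ((heightStep N M)^[k] e) z) :
    ∃ t, InWindow N M W e (wordThen t z) := by
  induction k generalizing e with
  | zero => exact ⟨[], by simpa using hz⟩
  | succ k ih =>
    rw [Function.iterate_succ_apply] at hz
    have hs := heightStep_iterate hM hMN 0 h0 (he.trans hWN)
    simp only [zero_add, Function.iterate_one] at hs
    obtain ⟨t, ht⟩ := ih hs.1 (by linarith [hs.2.1]) hz
    refine ⟨decide (e < M) :: t, ?_⟩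
    rw [wordThen_cons]
    refine ht.cons _ h0 he ?_
    unfold heightStep
    by_cases h : e < M <;> simp [h]

lemma InWindow.exists_wordThen {N M W : ℤ} {z : Seq} (hM : 0 < M) (hMN : M < N)
    (hco : IsCoprime M N) (hW : N - 1 ≤ W) (hWN : W ≤ N) {e e' : ℤ} (h0 : 0 ≤ e) (he : e ≤ W)
    (hz : InWindow N M W e' z) : ∃ t, InWindow N M W e (wordThen t z) := by
  have main : ∀ {r : ℤ} {z : Seq}, 0 ≤ r → r < N → InWindow N M W r z →
      ∃ t, InWindow N M W e (wordThen t z) := by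
    intro r z hr hr' hz
    obtain ⟨k, -, hk⟩ := exists_nat_dvd_sub_mul (hM.trans hMN) hco (e - M - r)
    obtain ⟨h1, h2, h3⟩ := heightStep_iterate hM hMN k h0 (he.trans hWN)
    refine InWindow.exists_wordThen_of_iterate hM hMN hW hWN (k + 1) h0 he ?_
    rwa [eq_of_dvd_sub_of_lt (b := r) ?_ h1 h2 hr hr']
    have := dvd_add h3 hk
    obtain ⟨c, hc⟩ := this
    exact ⟨c, by linear_combination hc⟩
  have hz' := hz
  obtain ⟨E, hE0, -, hE⟩ := hz'
  have hb := hE 0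
  rw [hE0] at hb
  by_cases h : e' < N
  · exact main hb.1 h hz
  · have heq : e' = N := by linarith [not_lt.mp h]
    have hM' : InWindow N M W M (consSeq true z) :=
      hz.cons true hM.le (by linarith) (by simp [heq])
    obtain ⟨t, ht⟩ := main hM.le hMN hM'
    refine ⟨t ++ [true], ?_⟩
    rwa [wordThen_append, wordThen_cons, wordThen_nil]

lemma transitiveShift_of_inWindow {N M W : ℤ} (hM : 0 < M) (hMN : M < N)
    (hco : IsCoprime M N) (hW : N - 1 ≤ W) (hWN : W ≤ N) {A : Set Seq}
    (hA : ∀ x, x ∈ A ↔ ∃ e, InWindow N M W e x) : TransitiveShift A := by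
  rintro u ⟨x, hx, hux⟩ v ⟨y, hy, hvy⟩
  obtain ⟨i, hi⟩ := hux.exists_eq_wordThen
  obtain ⟨j, hj⟩ := hvy.exists_eq_wordThen
  obtain ⟨-, E, -, hE, hEb⟩ := (hA x).1 hx
  obtain ⟨-, F, -, hF, hFb⟩ := (hA y).1 hy
  have hz : InWindow N M W (F j) (shift^[j] y) :=
    ⟨fun t => F (j + t), rfl, hF.shift_iterate j, fun t => hFb _⟩
  obtain ⟨t, ht⟩ := hz.exists_wordThen hM hMN hco hW hWN (hEb (i + u.length)).1
    (hEb (i + u.length)).2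
  have hut := (hE.shift_iterate i).inWindow_wordThen u hi (fun t => hEb _) ht
  refine ⟨t, ⟨_, (hA _).2 ⟨_, ht⟩, occursIn_wordThen _ _⟩, _, (hA _).2 ⟨_, hut⟩, ?_⟩
  rw [hj, ← wordThen_append, ← wordThen_append]
  exact occursIn_wordThen _ _

/-! ### Sequences built from two balanced words -/

lemma isUpper_shift {N M : ℤ} {n g : ℕ} (hM : 0 < M) (hMN : M < N) (hco : IsCoprime M N)
    (hg : 0 < g) (hn : (n : ℤ) = g * N) {p q a : Seq} {E F : ℕ → ℤ}
    (hp : IsHeight N M p E) (hE : ∀ t, 0 ≤ E t ∧ E t < N) (hE0 : E 0 = M)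
    (hp0 : p 0 = false)
    (hq : IsHeight N M q F) (hF : ∀ t, 0 ≤ F t ∧ F t < N) (hF0 : F 0 = M - 1)
    (ha : ∀ i, a i = if i < n then p i else q (i - n)) :
    IsUpper N M (if g = 1 then N else N - 1) (shift a) := by
  have hgz : (1 : ℤ) ≤ g := by exact_mod_cast hg
  have hnpos : 1 < n := by
    have : (1 : ℤ) < n := by nlinarith
    exact_mod_cast this
  have hEn : E n = M := by
    refine eq_of_dvd_sub_of_lt ?_ (hE n).1 (hE n).2 hM.le hMN
    have := hp.dvd n
    rw [hE0, hn] at this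
    have := dvd_sub this (dvd_mul_right N (g * M))
    obtain ⟨c, hc⟩ := this
    exact ⟨c, by linear_combination hc⟩
  set G : ℕ → ℤ := fun t => if t ≤ n then E t else F (t - n) + 1 with hG
  have hGlow : ∀ t, t ≤ n → G t = E t := fun t ht => by simp [hG, ht]
  have hGhigh : ∀ t, n ≤ t → G t = F (t - n) + 1 := by
    intro t ht
    rcases ht.eq_or_lt with rfl | h
    · simp [hG, hEn, hF0]
    · simp [hG, not_le.mpr h]
  have hah : IsHeight N M a G := by
    intro t
    rw [ha t]
    rcases Nat.lt_or_ge t n with h | h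
    · rw [hGlow _ h, hGlow _ h.le, if_pos h]
      exact hp t
    · rw [hGhigh _ (by omega), hGhigh _ h, if_neg (show ¬t < n by omega),
        show t + 1 - n = t - n + 1 by omega, hq (t - n)]
      ring
  have hGb : ∀ t, 0 ≤ G t ∧ G t ≤ N := by
    intro t
    rcases le_total t n with h | h
    · rw [hGlow t h]
      exact ⟨(hE t).1, (hE t).2.le⟩
    · rw [hGhigh t h]
      have := hF (t - n)
      exact ⟨by linarith, by linarith⟩
  have hE1 : E 1 = 0 := by
    have := hp.of_false hp0
    simpa [hE0] using this
  refine ⟨fun t => G (1 + t), ?_, fun t => hGb _, hah.shift_iterate 1, ?_⟩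
  · simp [hGlow 1 hnpos.le, hE1]
  · by_cases h1 : g = 1
    · left
      refine ⟨by simp [h1], fun t ht => ?_⟩
      simp only at ht
      change a (t + 1) = true
      rw [add_comm, ha]
      rcases Nat.lt_or_ge (1 + t) n with h | h
      · exfalso
        rw [hGlow _ h.le] at ht
        have hd := hp.dvd (1 + t)
        rw [ht, hE0, show M - (M - ((1 + t : ℕ) : ℤ) * M) = ((1 + t : ℕ) : ℤ) * M by ring] at hd
        have hd' := hco.symm.dvd_of_dvd_mul_right hd
        have := Int.le_of_dvd (by positivity) hd'
        rw [h1] at hn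
        push_cast at this hn
        omega
      · rw [if_neg (by omega)]
        rw [hGhigh _ h] at ht
        by_contra hc
        have h2 := hq.of_false (Bool.eq_false_of_not_eq_true hc)
        have := (hF (1 + t - n + 1)).1
        linarith
    · right
      refine ⟨by simp [h1], N.toNat, by omega, ?_, ?_⟩
      all_goals
        have hg2 : (2 : ℤ) ≤ g := by exact_mod_cast (by omega : 2 ≤ g)
        have hNn : 1 + N.toNat ≤ n := by
          have : 1 + N ≤ n := by nlinarith
          omega
      · have hEN : E N.toNat = M := by
          refine eq_of_dvd_sub_of_lt ?_ (hE _).1 (hE _).2 hM.le hMN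
          have := hp.dvd N.toNat
          rw [hE0, Int.toNat_of_nonneg (by linarith)] at this
          have := dvd_sub this (dvd_mul_right N M)
          obtain ⟨c, hc⟩ := this
          exact ⟨c, by linear_combination hc⟩
        simp only
        rw [hGlow _ hNn, add_comm]
        have hf : p N.toNat = false := by
          by_contra hc
          have h2 := hp.of_true (Bool.eq_true_of_not_eq_false hc)
          have := (hE (N.toNat + 1)).2
          linarith
        rw [hp.of_false hf, hEN, sub_self]
      · intro t ht
        simp only
        rw [hGlow _ (by omega)]
        exact (hE _).2

/-! ### Finite words -/

lemma periodicSeq_rot {w : List Bool} {k : ℕ} (hk : k < w.length) :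
    periodicSeq (rot w k) = shift^[k] (periodicSeq w) := by
  funext t
  have hl : (rot w k).length = w.length := by simp [rot]; omega
  rw [shift_iterate_apply]
  simp only [periodicSeq, hl]
  have hr : t % w.length < w.length := Nat.mod_lt _ (by omega)
  rw [Nat.add_mod k t, Nat.mod_eq_of_lt hk]
  generalize t % w.length = r at hr ⊢
  unfold rot
  rcases Nat.lt_or_ge (k + r) w.length with h | h
  · rw [Nat.mod_eq_of_lt h, List.getD_append _ _ _ _ (by simp; omega)]
    simp [List.getD_eq_getElem?_getD]
  · have : (k + r) % w.length = k + r - w.length := by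
      rw [Nat.mod_eq_sub_mod h, Nat.mod_eq_of_lt (by omega)]
    rw [this, List.getD_append_right _ _ _ _ (by simp; omega)]
    simp only [List.length_drop, List.getD_eq_getElem?_getD]
    rw [List.getElem?_take_of_lt (by omega)]
    congr 2
    omega

lemma exists_getD_lt_of_lex {u v : List Bool} (hl : u.length = v.length)
    (h : List.Lex (· < ·) u v) : ∃ k, k < u.length ∧
      (∀ i, i < k → u.getD i false = v.getD i false) ∧ u.getD k false < v.getD k false := by
  induction h with
  | nil => simp at hl
  | cons _ ih =>
    obtain ⟨k, hk, h1, h2⟩ := ih (by simpa using hl)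
    refine ⟨k + 1, by simpa using hk, fun i hi => ?_, by simpa using h2⟩
    rcases i with _ | i
    · simp
    · simpa using h1 i (by omega)
  | rel hab => exact ⟨0, by simp, fun i hi => by omega, by simpa using hab⟩

lemma lexLe_periodicSeq {u v : List Bool} (hl : u.length = v.length) (h : listLe u v) :
    lexLe (periodicSeq u) (periodicSeq v) := by
  rcases h with h | rfl
  · obtain ⟨k, hk, h1, h2⟩ := exists_getD_lt_of_lex hl h
    refine Or.inl ⟨k, fun i hi => ?_, ?_⟩
    · simp only [periodicSeq, ← hl, Nat.mod_eq_of_lt (hi.trans hk)]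
      exact h1 i hi
    · simpa only [periodicSeq, ← hl, Nat.mod_eq_of_lt hk] using h2
  · exact Or.inr rfl

lemma length_rot (w : List Bool) (k : ℕ) : (rot w k).length = w.length := by
  simp [rot]
  omega

lemma headD_eq_periodicSeq {w : List Bool} (hw : w ≠ []) (b : Bool) :
    w.headD b = periodicSeq w 0 := by
  cases w with
  | nil => exact absurd rfl hw
  | cons a w => simp [periodicSeq]

lemma headD_rot {w : List Bool} {k : ℕ} (hk : k < w.length) (b : Bool) :
    (rot w k).headD b = periodicSeq w k := by
  have hne : rot w k ≠ [] := by
    intro h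
    have := length_rot w k
    rw [h] at this
    simp at this
    omega
  rw [headD_eq_periodicSeq hne, periodicSeq_rot hk, shift_iterate_apply, add_zero]

lemma isZeroMax.lexLe_shift {w : List Bool} (h : isZeroMax w) {k : ℕ} (hk : k < w.length)
    (h0 : periodicSeq w k = false) : lexLe (shift^[k] (periodicSeq w)) (periodicSeq w) := by
  rw [← periodicSeq_rot hk]
  exact lexLe_periodicSeq (length_rot w k) (h.2 k hk (by rw [headD_rot hk, h0]))

lemma isOneMin.lexLe_shift {w : List Bool} (h : isOneMin w) {k : ℕ} (hk : k < w.length)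
    (h0 : periodicSeq w k = true) : lexLe (periodicSeq w) (shift^[k] (periodicSeq w)) := by
  rw [← periodicSeq_rot hk]
  exact lexLe_periodicSeq (length_rot w k).symm (h.2 k hk (by rw [headD_rot hk, h0]))

lemma periodicSeq_add_length (w : List Bool) (i : ℕ) :
    periodicSeq w (i + w.length) = periodicSeq w i := by
  simp [periodicSeq]

/-- The number of ones among the first `i` letters. -/
def prefixCount (x : Seq) (i : ℕ) : ℤ := ∑ k ∈ Finset.range i, if x k then 1 else 0

lemma prefixCount_succ (x : Seq) (i : ℕ) :
    prefixCount x (i + 1) = prefixCount x i + if x i then 1 else 0 :=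
  Finset.sum_range_succ _ _

lemma count_take_eq_prefixCount {w : List Bool} {x : Seq} {i : ℕ} (hi : i ≤ w.length)
    (hx : ∀ k (h : k < w.length), w[k] = x k) :
    ((w.take i).count true : ℤ) = prefixCount x i := by
  induction i with
  | zero => simp [prefixCount]
  | succ i ih =>
    have h : i < w.length := by omega
    rw [prefixCount_succ, ← ih h.le, ← List.take_concat_get' w i h, List.count_append, hx i h]
    cases x i <;> simp

lemma getElem_append_self (w : List Bool) (k : ℕ) (h : k < (w ++ w).length) :
    (w ++ w)[k] = periodicSeq w k := by
  simp only [List.length_append] at h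
  rcases Nat.lt_or_ge k w.length with hk | hk
  · rw [List.getElem_append_left hk]
    simp [periodicSeq, Nat.mod_eq_of_lt hk, hk]
  · rw [List.getElem_append_right hk]
    have : k % w.length = k - w.length := by
      rw [Nat.mod_eq_sub_mod hk, Nat.mod_eq_of_lt (by omega)]
    have h' : k - w.length < w.length := by omega
    simp [periodicSeq, this, h']

lemma prefixCount_add_length (w : List Bool) (i : ℕ) :
    prefixCount (periodicSeq w) (i + w.length) =
      prefixCount (periodicSeq w) i + w.count true := by
  induction i with
  | zero =>
    have := count_take_eq_prefixCount (x := periodicSeq w) (le_refl w.length) fun k h => by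
      simp [periodicSeq, Nat.mod_eq_of_lt h, h]
    rw [List.take_length] at this
    simp [this, prefixCount]
  | succ i ih =>
    rw [show i + 1 + w.length = i + w.length + 1 by ring, prefixCount_succ, prefixCount_succ, ih,
      periodicSeq_add_length]
    ring

lemma prefixCount_add_mul_length (w : List Bool) (i c : ℕ) :
    prefixCount (periodicSeq w) (i + c * w.length) =
      prefixCount (periodicSeq w) i + c * w.count true := by
  induction c with
  | zero => simp
  | succ c ih =>
    rw [show i + (c + 1) * w.length = i + c * w.length + w.length by ring,
      prefixCount_add_length, ih]
    push_cast
    ring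

lemma cycBalanced.prefixCount_sub_le {w : List Bool} (hw : w ≠ []) (h : cycBalanced w)
    {l : ℕ} (hl : l ≤ w.length) (i j : ℕ) :
    (prefixCount (periodicSeq w) (i + l) - prefixCount (periodicSeq w) i) -
      (prefixCount (periodicSeq w) (j + l) - prefixCount (periodicSeq w) j) ≤ 1 := by
  have hpos : 0 < w.length := List.length_pos_iff.mpr hw
  have hred : ∀ i, prefixCount (periodicSeq w) (i + l) - prefixCount (periodicSeq w) i =
      ((((w ++ w).drop (i % w.length)).take l).count true : ℤ) := by
    intro i
    have hi := Nat.mod_lt i hpos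
    have hdm := Nat.mod_add_div' i w.length
    have h1 := prefixCount_add_mul_length w (i % w.length) (i / w.length)
    have h2 := prefixCount_add_mul_length w (i % w.length + l) (i / w.length)
    rw [hdm] at h1
    rw [show i % w.length + l + i / w.length * w.length = i + l by omega] at h2
    rw [h1, h2]
    have h3 := count_take_eq_prefixCount (w := w ++ w) (x := periodicSeq w)
      (i := i % w.length) (by simp; omega) (getElem_append_self w)
    have h4 := count_take_eq_prefixCount (w := w ++ w) (x := periodicSeq w)
      (i := i % w.length + l) (by simp; omega) (getElem_append_self w)
    rw [← h3, ← h4, List.take_add, List.count_append]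
    push_cast
    ring
  rw [hred i, hred j]
  have hinf : ∀ a, ((w ++ w).drop a).take l <:+: w ++ w := fun a =>
    (List.take_prefix _ _).isInfix.trans (List.drop_suffix _ _).isInfix
  have hlen : ∀ i, (((w ++ w).drop (i % w.length)).take l).length = l := by
    intro i
    have hi := Nat.mod_lt i hpos
    simp
    omega
  have := h _ _ (hinf (i % w.length)) (hinf (j % w.length)) (by rw [hlen, hlen])
  omega

lemma sum_prefixCount_blocks (x : Seq) (i l c : ℕ) :
    ∑ k ∈ Finset.range c, (prefixCount x (i + k * l + l) - prefixCount x (i + k * l)) =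
      prefixCount x (i + c * l) - prefixCount x i := by
  have := Finset.sum_range_sub (fun k => prefixCount x (i + k * l)) c
  simp only [zero_mul, add_zero] at this
  rw [← this]
  refine Finset.sum_congr rfl fun k _ => ?_
  rw [show i + (k + 1) * l = i + k * l + l by ring]

lemma cycBalanced.abs_lt {w : List Bool} (hw : w ≠ []) (h : cycBalanced w)
    {l : ℕ} (hl : l ≤ w.length) (i : ℕ) :
    |(w.length : ℤ) * (prefixCount (periodicSeq w) (i + l) - prefixCount (periodicSeq w) i) -
      l * w.count true| < w.length := by
  have hpos : 0 < w.length := List.length_pos_iff.mpr hw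
  set P := prefixCount (periodicSeq w) with hP
  have hsum := sum_prefixCount_blocks (periodicSeq w) i l w.length
  rw [mul_comm w.length l, prefixCount_add_mul_length, ← hP, add_sub_cancel_left] at hsum
  have h0 : (0 : ℕ) ∈ Finset.range w.length := Finset.mem_range.mpr hpos
  have hupper := Finset.sum_lt_sum (s := Finset.range w.length)
    (f := fun k => P (i + k * l + l) - P (i + k * l)) (g := fun _ => P (i + l) - P i + 1)
    (fun k _ => by
      have := h.prefixCount_sub_le hw hl (i + k * l) i
      simp only [← hP] at this
      linarith)
    ⟨0, h0, by simp⟩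
  have hlower := Finset.sum_lt_sum (s := Finset.range w.length)
    (g := fun k => P (i + k * l + l) - P (i + k * l)) (f := fun _ => P (i + l) - P i - 1)
    (fun k _ => by
      have := h.prefixCount_sub_le hw hl i (i + k * l)
      simp only [← hP] at this
      linarith)
    ⟨0, h0, by simp⟩
  rw [hsum] at hupper hlower
  simp only [Finset.sum_const, Finset.card_range, nsmul_eq_mul] at hupper hlower
  rw [_root_.abs_lt]
  constructor <;> nlinarith

/-- The heights of a cyclically balanced word stay in a window of `N` consecutive values. -/
lemma cycBalanced.exists_isHeight {w : List Bool} (hw : w ≠ []) (h : cycBalanced w)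
    {N M : ℤ} {g : ℕ} (hg : 0 < g) (hn : (w.length : ℤ) = g * N)
    (hm : (w.count true : ℤ) = g * M) :
    ∃ E, IsHeight N M (periodicSeq w) E ∧ ∀ t, 0 ≤ E t ∧ E t < N := by
  have hgz : (0 : ℤ) < g := by exact_mod_cast hg
  have hpos : 0 < w.length := List.length_pos_iff.mpr hw
  set D : ℕ → ℤ := fun t => N * prefixCount (periodicSeq w) t - M * t with hD
  have hDh : IsHeight N M (periodicSeq w) D := by
    intro t
    simp only [hD, prefixCount_succ]
    push_cast
    split_ifs <;> ring
  have hper : ∀ i, D (i % w.length) = D i := by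
    intro i
    have h1 := prefixCount_add_mul_length w (i % w.length) (i / w.length)
    have hdm := Nat.mod_add_div' i w.length
    rw [hdm] at h1
    have hdm' : ((i % w.length : ℕ) : ℤ) + (i / w.length : ℕ) * (w.length : ℕ) = i := by
      exact_mod_cast hdm
    simp only [hD]
    rw [h1, ← hdm', hn, hm]
    ring
  have hshort : ∀ i l, l ≤ w.length → |D (i + l) - D i| < N := by
    intro i l hl
    have h1 := h.abs_lt hw hl i
    have h2 : (w.length : ℤ) * (prefixCount (periodicSeq w) (i + l) -
        prefixCount (periodicSeq w) i) - l * w.count true = g * (D (i + l) - D i) := by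
      simp only [hD]
      rw [hn, hm]
      push_cast
      ring
    rw [h2, abs_mul, abs_of_pos hgz, hn] at h1
    exact lt_of_mul_lt_mul_left h1 hgz.le
  have hbd : ∀ i j, D i - D j < N := by
    intro i j
    rw [← hper i, ← hper j]
    have hi := Nat.mod_lt i hpos
    have hj := Nat.mod_lt j hpos
    generalize i % w.length = i at hi ⊢
    generalize j % w.length = j at hj ⊢
    rcases le_total i j with hij | hij
    · have := _root_.abs_lt.mp (hshort i (j - i) (by omega))
      rw [Nat.add_sub_cancel' hij] at this
      linarith
    · have := _root_.abs_lt.mp (hshort j (i - j) (by omega))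
      rw [Nat.add_sub_cancel' hij] at this
      linarith
  obtain ⟨d, ⟨j, hj⟩, hd⟩ := Int.exists_least_of_bdd (P := fun d => ∃ j, D j = d)
    ⟨D 0 - N, fun z ⟨j, hj⟩ => by have := hbd 0 j; linarith⟩ ⟨D 0, 0, rfl⟩
  refine ⟨fun t => D t - d, hDh.sub_const d, fun t => ⟨?_, ?_⟩⟩
  · have := hd (D t) ⟨t, rfl⟩
    linarith
  · have := hbd t j
    linarith

lemma wordThen_periodicSeq_apply (w : List Bool) (x : Seq) (i : ℕ) :
    wordThen w x i = if i < w.length then periodicSeq w i else x (i - w.length) := by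
  unfold wordThen
  split_ifs with h
  · simp [periodicSeq, Nat.mod_eq_of_lt h]
  · rfl

/-- if ω and ν are cyclically balanced words with ω = 0-max_ω,
ν = 1-min_ν, ℓ(ω) = ℓ(ν) and 1(ω) = 1(ν), then the lexicographic subshift with
α = σ(ων^∞) and β = σ(νω^∞) is topologically transitive. -/
theorem statement15 (ω ν : List Bool) (hω : ω ≠ []) (hν : ν ≠ [])
    (hcb1 : cycBalanced ω) (hcb2 : cycBalanced ν)
    (h0 : isZeroMax ω) (h1 : isOneMin ν)
    (hlen : ω.length = ν.length) (hcount : ω.count true = ν.count true) :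
    TransitiveShift
      (lexSubshift (shift (wordThen ω (periodicSeq ν)))
        (shift (wordThen ν (periodicSeq ω)))) := by
  have hω0 : periodicSeq ω 0 = false := by rw [← headD_eq_periodicSeq hω true, h0.1]
  have hν0 : periodicSeq ν 0 = true := by rw [← headD_eq_periodicSeq hν false, h1.1]
  have hmpos : 0 < ω.count true := by
    rw [hcount, List.count_pos_iff]
    cases ν with
    | nil => exact absurd rfl hν
    | cons b ν => simp_all [periodicSeq]
  have hmlt : ω.count true < ω.length := by
    refine lt_of_le_of_ne List.count_le_length fun h => ?_
    cases ω with
    | nil => exact hω rfl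
    | cons b ω =>
      have hb := List.count_eq_length.mp h b (by simp)
      simp [periodicSeq, ← hb] at hω0
  obtain ⟨g, M, N, hg, hco, hm, hn⟩ :=
    Nat.exists_coprime' (Nat.gcd_pos_of_pos_left ω.length hmpos)
  have hgz : (0 : ℤ) < g := by exact_mod_cast hg
  have hM : (0 : ℤ) < M := by
    have : 0 < M := Nat.pos_of_ne_zero fun h => by simp [h] at hm; omega
    exact_mod_cast this
  have hMN : (M : ℤ) < N := by
    have : M < N := lt_of_mul_lt_mul_right (a := g) (by omega) (Nat.zero_le _)
    exact_mod_cast this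
  have hcoz : IsCoprime (M : ℤ) (N : ℤ) := Nat.isCoprime_iff_coprime.mpr hco
  have hcoz' : IsCoprime ((N : ℤ) - M) (N : ℤ) := by
    obtain ⟨a, b, hab⟩ := hcoz
    exact ⟨-a, b + a, by linear_combination hab⟩
  have hnz : (ω.length : ℤ) = g * N := by rw [hn]; push_cast; ring
  have hmz : (ω.count true : ℤ) = g * M := by rw [hm]; push_cast; ring
  have hnz' : (ν.length : ℤ) = g * N := by rw [← hlen, hnz]
  have hmz' : (ν.count true : ℤ) = g * M := by rw [← hcount, hmz]
  have hNle : (N : ℤ) ≤ ω.length := by rw [hnz]; nlinarith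
  obtain ⟨E, hE, hEb⟩ := hcb1.exists_isHeight hω hg hnz hmz
  obtain ⟨F, hF, hFb⟩ := hcb2.exists_isHeight hν hg hnz' hmz'
  have hFb' : ∀ t, 0 ≤ (N : ℤ) - 1 - F t ∧ (N : ℤ) - 1 - F t < N := fun t =>
    ⟨by linarith [(hFb t).2], by linarith [(hFb t).1]⟩
  have hEb' : ∀ t, 0 ≤ (N : ℤ) - 1 - E t ∧ (N : ℤ) - 1 - E t < N := fun t =>
    ⟨by linarith [(hEb t).2], by linarith [(hEb t).1]⟩
  have hE0 : E 0 = M := hE.zero_eq_of_max hM hMN hcoz hEb hω0 fun k hk hx =>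
    h0.lexLe_shift (by omega) hx
  have hF0' := (hF.mirror (N - 1)).zero_eq_of_max (by linarith) (by linarith) hcoz' hFb'
    (by simp [mirror, hν0]) fun k hk hx => by
      have := lexLe_mirror (h1.lexLe_shift (k := k) (by omega) (by simpa [mirror] using hx))
      convert this using 1
      funext t
      simp [shift_iterate_apply, mirror]
  have hα := isUpper_shift hM hMN hcoz hg hnz hE hEb hE0 hω0 hF hFb (by linarith)
    (wordThen_periodicSeq_apply ω (periodicSeq ν))
  have hβ := isUpper_shift (a := mirror (wordThen ν (periodicSeq ω))) (by linarith) (by linarith)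
    hcoz' hg hnz' (hF.mirror (N - 1)) hFb' hF0' (by simp [mirror, hν0]) (hE.mirror (N - 1)) hEb'
    (by linarith) fun i => by
      simp only [mirror, wordThen_periodicSeq_apply]
      split_ifs <;> rfl
  have hW : (N : ℤ) - 1 ≤ (if g = 1 then (N : ℤ) else N - 1) := by split_ifs <;> linarith
  have hWN : (if g = 1 then (N : ℤ) else N - 1) ≤ (N : ℤ) := by split_ifs <;> linarith
  exact transitiveShift_of_inWindow hM hMN hcoz hW hWN
    (mem_lexSubshift_iff_inWindow (by linarith) hα hβ)

end DoublingHole
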